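/- For every n ≥ 0, the number of noncrossing trees on n+1 linearly ordered vertices equals the number of 3-ary (ternary) planar rooted trees with exactly n internal vertices. -/

import Mathlib

/-- A `k`-ary planar rooted tree: either a leaf, or an internal (node) vertex
with `k` ordered subtrees. -/
inductive PTree (k : ℕ) : Type where
  | leaf : PTree k
  | node : (Fin k → PTree k) → PTree k

/-- The number of internal vertices (occurrences of the `node` constructor). -/
def PTree.internal {k : ℕ} : PTree k → ℕ
  | .leaf => 0
  | .node f => 1 + ∑ i, (f i).internal

/-- A graph on the linearly ordered vertex set `Fin m` is noncrossing if there are no two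
edges `{a,b}` and `{c,d}` with `a < c < b < d`. -/
def SimpleGraph.Noncrossing {m : ℕ} (G : SimpleGraph (Fin m)) : Prop :=
  ∀ a b c d : Fin m, G.Adj a b → G.Adj c d → ¬(a < c ∧ c < b ∧ b < d)

namespace SimpleGraph

variable {V W : Type*}

lemma Reachable.of_forall_adj {G : SimpleGraph V} {P : V → Prop}
    (hP : ∀ x y, G.Adj x y → P x → P y) {u v : V} (h : G.Reachable u v) (hu : P u) : P v := by
  obtain ⟨p⟩ := h
  induction p with
  | nil => exact hu
  | cons hadj _ ih => exact ih (hP _ _ hadj hu)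

/-- A vertex map that contracts or preserves every edge preserves reachability. -/
lemma Reachable.of_contraction {G : SimpleGraph V} {H : SimpleGraph W} (f : V → W)
    (hf : ∀ x y, G.Adj x y → f x = f y ∨ H.Adj (f x) (f y)) {u v : V} (h : G.Reachable u v) :
    H.Reachable (f u) (f v) := by
  refine h.of_forall_adj (P := fun w ↦ H.Reachable (f u) (f w)) (fun x y hxy hx ↦ ?_) .rfl
  rcases hf x y hxy with h | h
  · exact h ▸ hx
  · exact hx.trans h.reachable

/-- An edge is a bridge if some contraction onto an acyclic graph preserves it and maps no other
edge onto its image. -/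
lemma IsAcyclic.isBridge_of_contraction {G : SimpleGraph V} {H : SimpleGraph W}
    (hH : H.IsAcyclic) (f : V → W) {x y : V} (hxy : H.Adj (f x) (f y))
    (hf : ∀ u v, G.Adj u v →
      f u = f v ∨ H.Adj (f u) (f v) ∧ (s(f u, f v) = s(f x, f y) → s(u, v) = s(x, y))) :
    G.IsBridge s(x, y) := by
  rw [isBridge_iff]
  intro h
  refine isBridge_iff.1 (isAcyclic_iff_forall_adj_isBridge.1 hH hxy) (h.of_contraction f ?_)
  intro u v huv
  rw [deleteEdges_adj, Set.mem_singleton_iff] at huv ⊢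
  rcases hf u v huv.1 with h | ⟨h, h'⟩
  · exact .inl h
  · exact .inr ⟨h, fun e ↦ huv.2 (h' e)⟩

lemma IsAcyclic.map {G : SimpleGraph V} (hG : G.IsAcyclic) (f : V ↪ W) : (G.map f).IsAcyclic := by
  rw [isAcyclic_iff_forall_adj_isBridge]
  intro x y hxy
  obtain ⟨-, u, v, huv, rfl, rfl⟩ := hxy
  have : Nonempty V := ⟨u⟩
  have hinv := Function.leftInverse_invFun f.injective
  refine hG.isBridge_of_contraction (Function.invFun f) (by rwa [hinv, hinv]) ?_
  rintro _ _ ⟨-, w, z, hwz, rfl, rfl⟩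
  rw [hinv, hinv, hinv, hinv]
  refine .inr ⟨hwz, fun h ↦ ?_⟩
  simpa using congrArg (Sym2.map f) h

/-- Gluing acyclic graphs on either side of a vertex `m` yields an acyclic graph. -/
lemma IsAcyclic.sup_of_le_of_ge {G H : SimpleGraph ℕ} (hG : G.IsAcyclic) (hH : H.IsAcyclic) (m : ℕ)
    (hGm : ∀ x y, G.Adj x y → x ≤ m) (hHm : ∀ x y, H.Adj x y → m ≤ x) : (G ⊔ H).IsAcyclic := by
  rw [isAcyclic_iff_forall_adj_isBridge]
  rintro x y (hxy | hxy)
  · have hx := hGm _ _ hxy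
    have hy := hGm _ _ hxy.symm
    refine hG.isBridge_of_contraction (min m) (by simpa [hx, hy] using hxy) ?_
    rintro u v (huv | huv)
    · simp [hx, hy, hGm _ _ huv, hGm _ _ huv.symm, huv]
    · simp [hHm _ _ huv, hHm _ _ huv.symm]
  · have hx := hHm _ _ hxy
    have hy := hHm _ _ hxy.symm
    refine hH.isBridge_of_contraction (max m) (by simpa [hx, hy] using hxy) ?_
    rintro u v (huv | huv)
    · simp [hGm _ _ huv, hGm _ _ huv.symm]
    · simp [hx, hy, hHm _ _ huv, hHm _ _ huv.symm, huv]

/-- `G` is a noncrossing tree on the interval `[a, b]`; the other vertices are isolated. -/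
structure IsNoncrossingTreeOn (G : SimpleGraph ℕ) (a b : ℕ) : Prop where
  mem : ∀ x y, G.Adj x y → a ≤ x ∧ x ≤ b
  reachable : ∀ x, a ≤ x → x ≤ b → G.Reachable a x
  acyclic : G.IsAcyclic
  noncrossing : ∀ u v x y, G.Adj u v → G.Adj x y → ¬(u < x ∧ x < v ∧ v < y)

namespace IsNoncrossingTreeOn

variable {T₁ T₂ T₃ S₁ S₂ S₃ G : SimpleGraph ℕ} {a b q r m l : ℕ}

lemma bot (a : ℕ) : IsNoncrossingTreeOn ⊥ a a where
  mem _ _ h := h.elim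
  reachable x h h' := by rw [le_antisymm h h']
  acyclic := isAcyclic_bot
  noncrossing _ _ _ _ h := h.elim

lemma eq_bot (h : IsNoncrossingTreeOn G a a) : G = ⊥ := by
  ext x y
  simp only [bot_adj, iff_false]
  intro hxy
  have h₁ := h.mem _ _ hxy
  have h₂ := h.mem _ _ hxy.symm
  exact hxy.ne (by omega)

lemma le_of_reachable_sup (h₁ : IsNoncrossingTreeOn T₁ a q)
    (h₂ : IsNoncrossingTreeOn T₂ (q + 1) m) (h₃ : IsNoncrossingTreeOn T₃ m b)
    (haq : a ≤ q) (hqm : q < m) {x : ℕ} (h : (T₁ ⊔ T₂ ⊔ T₃).Reachable a x) : x ≤ q := by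
  refine h.of_forall_adj (P := (· ≤ q)) ?_ haq
  rintro x y ((hxy | hxy) | hxy) hx
  · exact (h₁.mem _ _ hxy.symm).2
  · have := h₂.mem _ _ hxy
    omega
  · have := h₃.mem _ _ hxy
    omega

lemma glue (h₁ : IsNoncrossingTreeOn T₁ a q) (h₂ : IsNoncrossingTreeOn T₂ (q + 1) m)
    (h₃ : IsNoncrossingTreeOn T₃ m b) (haq : a ≤ q) (hqm : q < m) (hmb : m ≤ b) :
    IsNoncrossingTreeOn (T₁ ⊔ T₂ ⊔ T₃ ⊔ edge a m) a b where
  mem x y hxy := by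
    rcases hxy with ((hxy | hxy) | hxy) | hxy
    · have := h₁.mem _ _ hxy
      omega
    · have := h₂.mem _ _ hxy
      omega
    · have := h₃.mem _ _ hxy
      omega
    · rw [edge_adj] at hxy
      omega
  reachable x hax hxb := by
    have ham : (T₁ ⊔ T₂ ⊔ T₃ ⊔ edge a m).Reachable a m :=
      Adj.reachable (.inr (by rw [edge_adj]; omega))
    have le₂ : T₂ ≤ T₁ ⊔ T₂ ⊔ T₃ ⊔ edge a m := fun _ _ h ↦ .inl (.inl (.inr h))
    rcases le_or_gt x q with hxq | hxq
    · exact (h₁.reachable x hax hxq).mono fun _ _ h ↦ .inl (.inl (.inl h))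
    rcases le_or_gt x m with hxm | hxm
    · exact ham.trans (((h₂.reachable m hqm le_rfl).symm.trans (h₂.reachable x hxq hxm)).mono le₂)
    · exact ham.trans ((h₃.reachable x hxm.le hxb).mono fun _ _ h ↦ .inl (.inr h))
  acyclic := by
    refine IsAcyclic.sup_edge_of_not_reachable
      (fun h ↦ hqm.not_ge (h₁.le_of_reachable_sup h₂ h₃ haq hqm h)) ?_
    refine (h₁.acyclic.sup_of_le_of_ge h₂.acyclic q (fun x y h ↦ (h₁.mem x y h).2) fun x y h ↦
      (Nat.le_succ q).trans (h₂.mem x y h).1).sup_of_le_of_ge h₃.acyclic m ?_ fun x y h ↦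
        (h₃.mem x y h).1
    rintro x y (h | h)
    · exact (h₁.mem x y h).2.trans hqm.le
    · exact (h₂.mem x y h).2
  noncrossing u v x y huv hxy := by
    simp only [sup_adj, edge_adj] at huv hxy
    have m₁ := h₁.mem
    have m₂ := h₂.mem
    have m₃ := h₃.mem
    have n₁ := h₁.noncrossing u v x y
    have n₂ := h₂.noncrossing u v x y
    have n₃ := h₃.noncrossing u v x y
    rcases huv with ((huv | huv) | huv) | huv <;> rcases hxy with ((hxy | hxy) | hxy) | hxy <;>
      grind [SimpleGraph.adj_comm]

/-- In a noncrossing graph, a walk leaving the interval under an edge visits an end of that edge. -/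
lemma _root_.SimpleGraph.Reachable.mem_Ioo_of_noncrossing {x y p z : ℕ}
    (hG : ∀ u v x y, G.Adj u v → G.Adj x y → ¬(u < x ∧ x < v ∧ v < y)) (hxy : G.Adj x y)
    (hp : x < p ∧ p < y) (hpx : ¬G.Reachable p x) (hpz : G.Reachable p z) : x < z ∧ z < y := by
  refine (hpz.of_forall_adj (P := fun z ↦ G.Reachable p z ∧ x < z ∧ z < y) ?_ ⟨.rfl, hp⟩).2
  rintro u v huv ⟨hpu, hu⟩
  have hpv := hpu.trans huv.reachable
  have hvx : v ≠ x := by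
    rintro rfl
    exact hpx hpv
  have hvy : v ≠ y := by
    rintro rfl
    exact hpx (hpv.trans hxy.symm.reachable)
  have h₁ := hG x y u v hxy huv
  have h₂ := hG v u x y huv.symm hxy
  exact ⟨hpv, by omega⟩

/-- A subgraph of a noncrossing tree supported on `[c, d]`, onto which the tree contracts by a map
fixing `[c, d]`, is a noncrossing tree on `[c, d]`. -/
lemma of_contraction {T : SimpleGraph ℕ} {c d : ℕ} (hG : IsNoncrossingTreeOn G a b) (hT : T ≤ G)
    (hmem : ∀ x y, T.Adj x y → c ≤ x ∧ x ≤ d) (hac : a ≤ c) (hdb : d ≤ b) (f : ℕ → ℕ)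
    (hf : ∀ x, c ≤ x → x ≤ d → f x = x) (hadj : ∀ x y, G.Adj x y → f x = f y ∨ T.Adj (f x) (f y)) :
    IsNoncrossingTreeOn T c d where
  mem := hmem
  reachable x hcx hxd := by
    have := ((hG.reachable c hac (by omega)).symm.trans
      (hG.reachable x (by omega) (by omega))).of_contraction f hadj
    rwa [hf c le_rfl (by omega), hf x hcx hxd] at this
  acyclic := hG.acyclic.anti hT
  noncrossing u v x y huv hxy := hG.noncrossing u v x y (hT huv) (hT hxy)

/-- The restriction of a graph on `ℕ` to the edges inside `[c, d]`. -/
def _root_.SimpleGraph.restrictIcc (G : SimpleGraph ℕ) (c d : ℕ) : SimpleGraph ℕ where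
  Adj x y := G.Adj x y ∧ (c ≤ x ∧ x ≤ d) ∧ c ≤ y ∧ y ≤ d
  symm := ⟨fun _ _ h ↦ ⟨h.1.symm, h.2.2, h.2.1⟩⟩
  loopless := ⟨fun _ h ↦ h.1.ne rfl⟩

lemma exists_glue (h : IsNoncrossingTreeOn G a b) (hab : a < b) :
    ∃ q m T₁ T₂ T₃, a ≤ q ∧ q < m ∧ m ≤ b ∧ IsNoncrossingTreeOn T₁ a q ∧
      IsNoncrossingTreeOn T₂ (q + 1) m ∧ IsNoncrossingTreeOn T₃ m b ∧
      G = T₁ ⊔ T₂ ⊔ T₃ ⊔ edge a m := by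
  classical
  obtain ⟨c, hac⟩ : ∃ c, G.Adj a c := by
    by_contra! hc
    exact hab.ne' <| (h.reachable b hab.le le_rfl).of_forall_adj (P := (· = a))
      (fun x y hxy hx ↦ (hc y (hx ▸ hxy)).elim) rfl
  have hle : ∀ x, G.Adj a x → x ≤ b := fun x hx ↦ (h.mem _ _ hx.symm).2
  obtain ⟨m, ham, hmax⟩ : ∃ m, G.Adj a m ∧ ∀ x, G.Adj a x → x ≤ m :=
    ⟨Nat.findGreatest (G.Adj a) b, Nat.findGreatest_spec (hle c hac) hac,
      fun x hx ↦ Nat.le_findGreatest (hle x hx) hx⟩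
  have ham' : a < m := by
    have := (h.mem _ _ ham.symm).1
    have := ham.ne
    omega
  set D := G.deleteEdges {s(a, m)} with hD
  have hDadj : ∀ x y, D.Adj x y ↔ G.Adj x y ∧ ¬(x = a ∧ y = m ∨ x = m ∧ y = a) := by
    intro x y
    rw [hD, deleteEdges_adj, Set.mem_singleton_iff, Sym2.eq_iff]
  have hnr : ¬D.Reachable a m := isBridge_iff.1 (isAcyclic_iff_forall_adj_isBridge.1 h.acyclic ham)
  have hex : ∃ p, a ≤ p ∧ D.Reachable p m := ⟨m, ham'.le, .rfl⟩
  obtain ⟨p, ⟨hap, hpm⟩, hmin⟩ : ∃ p, (a ≤ p ∧ D.Reachable p m) ∧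
      ∀ x, a ≤ x → D.Reachable x m → p ≤ x :=
    ⟨Nat.find hex, Nat.find_spec hex, fun x hx hx' ↦ Nat.find_min' hex ⟨hx, hx'⟩⟩
  have hpm' : p ≤ m := hmin m ham'.le .rfl
  have hap' : a < p := hap.lt_of_ne (by rintro rfl; exact hnr hpm)
  have hcut : ∀ x y, D.Adj x y → x < p → y < p := by
    intro x y hxy hx
    by_contra! hy
    have hax := (h.mem _ _ ((hDadj _ _).1 hxy).1).1
    have hxm : ¬D.Reachable x m := fun h' ↦ hx.not_ge (hmin x hax h')
    have hym : ¬D.Reachable y m := fun h' ↦ hxm (hxy.reachable.trans h')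
    have hpy : p ≠ y := by
      rintro rfl
      exact hym hpm
    have hm := hpm.mem_Ioo_of_noncrossing
      (fun u v x y huv hxy ↦ h.noncrossing u v x y ((hDadj _ _).1 huv).1 ((hDadj _ _).1 hxy).1)
      hxy (by omega) (fun h' ↦ hxm (h'.symm.trans hpm))
    have hG := ((hDadj _ _).1 hxy).1
    rcases hax.eq_or_lt with rfl | hax
    · have := hmax _ hG
      omega
    · exact h.noncrossing a m x y ham hG (by omega)
  obtain ⟨q, rfl⟩ : ∃ q, p = q + 1 := ⟨p - 1, by omega⟩
  have hcutm : ∀ x y, G.Adj x y → x < m → y ≤ m := by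
    intro x y hxy hx
    by_contra! hy
    rcases (h.mem _ _ hxy).1.eq_or_lt with rfl | hax
    · exact hy.not_ge (hmax _ hxy)
    · exact h.noncrossing a m x y ham hxy ⟨hax, hx, hy⟩
  have hmem : ∀ x y, G.Adj x y → (a ≤ x ∧ x ≤ b) ∧ a ≤ y ∧ y ≤ b :=
    fun x y hxy ↦ ⟨h.mem _ _ hxy, h.mem _ _ hxy.symm⟩
  have hcut' : ∀ x y, G.Adj x y → x ≤ q → y ≤ q ∨ x = a ∧ y = m := by
    intro x y hxy hx
    by_cases he : x = a ∧ y = m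
    · exact .inr he
    · have := hcut x y ((hDadj x y).2 ⟨hxy, by omega⟩) (by omega)
      omega
  have hmb := hle m ham
  clear hcut hmin hpm hnr hDadj hD hmax hle hac hex D
  refine ⟨q, m, G.restrictIcc a q, G.restrictIcc (q + 1) m, G.restrictIcc m b, by omega, by omega,
    hmb, ?_, ?_, ?_, ?_⟩
  · refine h.of_contraction (fun _ _ h ↦ h.1) (fun _ _ h ↦ h.2.1) le_rfl (by omega)
      (fun x ↦ if x ≤ q then x else a) (fun x _ hx ↦ if_pos hx) fun x y hxy ↦ ?_
    have := hcut' x y hxy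
    have := hcut' y x hxy.symm
    have := hmem x y hxy
    simp only [restrictIcc]
    grind
  · refine h.of_contraction (fun _ _ h ↦ h.1) (fun _ _ h ↦ h.2.1) (by omega) hmb
      (fun x ↦ if q < x ∧ x ≤ m then x else m) (fun x h₁ h₂ ↦ if_pos ⟨h₁, h₂⟩) fun x y hxy ↦ ?_
    have h₁ := hcut' x y hxy
    have h₂ := hcut' y x hxy.symm
    have h₃ := hcutm x y hxy
    have h₄ := hcutm y x hxy.symm
    simp only [restrictIcc]
    split_ifs with hx hy hy
    · exact .inr ⟨hxy, hx, hy⟩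
    · exact .inl (by omega)
    · exact .inl (by omega)
    · exact .inl rfl
  · refine h.of_contraction (fun _ _ h ↦ h.1) (fun _ _ h ↦ h.2.1) (by omega) le_rfl
      (max m) (fun x hx _ ↦ max_eq_right hx) fun x y hxy ↦ ?_
    have := hcutm x y hxy
    have := hcutm y x hxy.symm
    have := hmem x y hxy
    simp only [restrictIcc]
    grind
  · ext x y
    simp only [sup_adj, restrictIcc, edge_adj]
    constructor
    · intro hxy
      have := hcut' x y hxy
      have := hcut' y x hxy.symm
      have := hcutm x y hxy
      have := hcutm y x hxy.symm
      have := hmem x y hxy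
      have := hxy.ne
      simp only [hxy, true_and]
      omega
    · rintro (((h | h) | h) | ⟨⟨rfl, rfl⟩ | ⟨rfl, rfl⟩, -⟩)
      exacts [h.1, h.1, h.1, ham, ham.symm]

lemma le_of_adj_glue (h₁ : IsNoncrossingTreeOn T₁ a q) (h₂ : IsNoncrossingTreeOn T₂ (q + 1) m)
    (h₃ : IsNoncrossingTreeOn T₃ m b) (haq : a ≤ q) (hqm : q < m) {x : ℕ}
    (h : (T₁ ⊔ T₂ ⊔ T₃ ⊔ edge a m).Adj a x) : x ≤ m := by
  rcases h with ((h | h) | h) | h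
  · have := h₁.mem _ _ h.symm
    omega
  · exact (h₂.mem _ _ h.symm).2
  · have := h₃.mem _ _ h
    omega
  · rw [edge_adj] at h
    omega

lemma le_of_glue_eq_glue
    (h₁ : IsNoncrossingTreeOn T₁ a q) (k₁ : IsNoncrossingTreeOn S₁ a r)
    (k₂ : IsNoncrossingTreeOn S₂ (r + 1) m) (k₃ : IsNoncrossingTreeOn S₃ m b)
    (hqm : q < m) (har : a ≤ r) (hrm : r < m)
    (h : T₁ ⊔ T₂ ⊔ T₃ ⊔ edge a m = S₁ ⊔ S₂ ⊔ S₃ ⊔ edge a m) : q ≤ r := by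
  by_contra! hlt
  have := k₁.le_of_reachable_sup k₂ k₃ har hrm
    ((h₁.reachable (r + 1) (by omega) (by omega)).mono fun x y hxy ↦ ?_)
  · omega
  have hS : (S₁ ⊔ S₂ ⊔ S₃ ⊔ edge a m).Adj x y := h ▸ .inl (.inl (.inl hxy))
  refine hS.resolve_right fun he ↦ ?_
  have := h₁.mem _ _ hxy
  have := h₁.mem _ _ hxy.symm
  rw [edge_adj] at he
  omega

lemma restrictIcc_glue (h₁ : IsNoncrossingTreeOn T₁ a q)
    (h₂ : IsNoncrossingTreeOn T₂ (q + 1) m) (h₃ : IsNoncrossingTreeOn T₃ m b)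
    (haq : a ≤ q) (hqm : q < m) :
    (T₁ ⊔ T₂ ⊔ T₃ ⊔ edge a m).restrictIcc a q = T₁ ∧
      (T₁ ⊔ T₂ ⊔ T₃ ⊔ edge a m).restrictIcc (q + 1) m = T₂ ∧
      (T₁ ⊔ T₂ ⊔ T₃ ⊔ edge a m).restrictIcc m b = T₃ := by
  have key : ∀ x y, T₁.Adj x y ∨ T₂.Adj x y ∨ T₃.Adj x y → x ≠ y := by
    rintro x y (h | h | h) <;> exact h.ne
  have m₁ := h₁.mem
  have m₂ := h₂.mem
  have m₃ := h₃.mem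
  refine ⟨?_, ?_, ?_⟩ <;> ext x y <;> have := key x y <;>
    simp only [restrictIcc, sup_adj, edge_adj] <;> grind [SimpleGraph.adj_comm]

lemma glue_inj (h₁ : IsNoncrossingTreeOn T₁ a q) (h₂ : IsNoncrossingTreeOn T₂ (q + 1) m)
    (h₃ : IsNoncrossingTreeOn T₃ m b) (haq : a ≤ q) (hqm : q < m)
    (k₁ : IsNoncrossingTreeOn S₁ a r) (k₂ : IsNoncrossingTreeOn S₂ (r + 1) l)
    (k₃ : IsNoncrossingTreeOn S₃ l b) (har : a ≤ r) (hrl : r < l)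
    (h : T₁ ⊔ T₂ ⊔ T₃ ⊔ edge a m = S₁ ⊔ S₂ ⊔ S₃ ⊔ edge a l) :
    q = r ∧ m = l ∧ T₁ = S₁ ∧ T₂ = S₂ ∧ T₃ = S₃ := by
  have hedge : ∀ {x} (H : SimpleGraph ℕ), a < x → (H ⊔ edge a x).Adj a x :=
    fun H hx ↦ .inr (by rw [edge_adj]; omega)
  obtain rfl : m = l := le_antisymm
    (k₁.le_of_adj_glue k₂ k₃ har hrl (h ▸ hedge _ (by omega)))
    (h₁.le_of_adj_glue h₂ h₃ haq hqm (h ▸ hedge _ (by omega)))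
  obtain rfl : q = r := le_antisymm
    (h₁.le_of_glue_eq_glue k₁ k₂ k₃ hqm har hrl h)
    (k₁.le_of_glue_eq_glue h₁ h₂ h₃ hrl haq hqm h.symm)
  obtain ⟨e₁, e₂, e₃⟩ := h₁.restrictIcc_glue h₂ h₃ haq hqm
  obtain ⟨f₁, f₂, f₃⟩ := k₁.restrictIcc_glue k₂ k₃ har hrl
  rw [h] at e₁ e₂ e₃
  exact ⟨rfl, rfl, e₁.symm.trans f₁, e₂.symm.trans f₂, e₃.symm.trans f₃⟩

lemma isTree_comap {n : ℕ} (h : IsNoncrossingTreeOn G 0 n) :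
    (G.comap (Fin.valEmbedding : Fin (n + 1) ↪ ℕ)).IsTree := by
  refine ⟨⟨fun x y ↦ ?_⟩, h.acyclic.of_comap _⟩
  have hr := (h.reachable x (by omega) (by omega)).symm.trans
    (h.reachable y (by omega) (by omega))
  have := hr.of_contraction (H := G.comap (Fin.valEmbedding : Fin (n + 1) ↪ ℕ))
    (Fin.ofNat (n + 1)) fun u v huv ↦ .inr ?_
  · simpa using this
  · have hu := h.mem _ _ huv
    have hv := h.mem _ _ huv.symm
    simpa [Nat.mod_eq_of_lt (Nat.lt_succ_of_le hu.2), Nat.mod_eq_of_lt (Nat.lt_succ_of_le hv.2)]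
      using huv

lemma of_isTree {n : ℕ} {G : SimpleGraph (Fin (n + 1))} (hG : G.IsTree) (hG' : G.Noncrossing) :
    IsNoncrossingTreeOn (G.map Fin.valEmbedding) 0 n where
  mem := by
    rintro _ _ ⟨-, x, y, _, rfl, rfl⟩
    exact ⟨Nat.zero_le _, Nat.le_of_lt_succ x.isLt⟩
  reachable x _ hx := (hG.connected.preconnected 0 ⟨x, Nat.lt_succ_of_le hx⟩).map
    (Embedding.map Fin.valEmbedding G).toHom
  acyclic := hG.isAcyclic.map _
  noncrossing := by
    rintro _ _ _ _ ⟨-, u, v, huv, rfl, rfl⟩ ⟨-, x, y, hxy, rfl, rfl⟩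
    exact hG' u v x y huv hxy

lemma map_comap {n : ℕ} (h : IsNoncrossingTreeOn G 0 n) :
    (G.comap (Fin.valEmbedding : Fin (n + 1) ↪ ℕ)).map Fin.valEmbedding = G := by
  ext x y
  constructor
  · rintro ⟨-, u, v, huv, rfl, rfl⟩
    exact huv
  · intro hxy
    exact ⟨hxy.ne, ⟨x, Nat.lt_succ_of_le (h.mem _ _ hxy).2⟩,
      ⟨y, Nat.lt_succ_of_le (h.mem _ _ hxy.symm).2⟩, hxy, rfl, rfl⟩

end IsNoncrossingTreeOn

end SimpleGraph

namespace PTree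

open SimpleGraph

lemma internal_node_three (f : Fin 3 → PTree 3) :
    (node f).internal = 1 + ((f 0).internal + (f 1).internal + (f 2).internal) := by
  rw [internal, Fin.sum_univ_three]

/-- The noncrossing tree on `[a, a + t.internal]` encoded by a ternary tree `t`: the last edge at
`a` corresponds to the root of `t`, and deleting it leaves the trees encoded by the three
subtrees. -/
def toGraph : PTree 3 → ℕ → SimpleGraph ℕ
  | leaf, _ => ⊥
  | node f, a =>
    (f 0).toGraph a ⊔ (f 1).toGraph (a + (f 0).internal + 1) ⊔
      (f 2).toGraph (a + (f 0).internal + 1 + (f 1).internal) ⊔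
      edge a (a + (f 0).internal + 1 + (f 1).internal)

lemma isNoncrossingTreeOn_toGraph (t : PTree 3) (a : ℕ) :
    IsNoncrossingTreeOn (t.toGraph a) a (a + t.internal) := by
  induction t generalizing a with
  | leaf => exact .bot a
  | node f ih =>
    have h₃ := ih 2 (a + (f 0).internal + 1 + (f 1).internal)
    rw [show a + (node f).internal = a + (f 0).internal + 1 + (f 1).internal + (f 2).internal by
      rw [internal_node_three]; omega]
    exact (ih 0 a).glue (ih 1 _) h₃ (by omega) (by omega) (by omega)

lemma toGraph_injective {t s : PTree 3} {a : ℕ} (hn : t.internal = s.internal)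
    (h : t.toGraph a = s.toGraph a) : t = s := by
  induction t generalizing s a with
  | leaf =>
    cases s with
    | leaf => rfl
    | node g =>
      rw [internal_node_three, internal] at hn
      omega
  | node f ih =>
    cases s with
    | leaf =>
      rw [internal_node_three, internal] at hn
      omega
    | node g =>
      rw [internal_node_three, internal_node_three] at hn
      have hb : a + (g 0).internal + 1 + (g 1).internal + (g 2).internal =
        a + (f 0).internal + 1 + (f 1).internal + (f 2).internal := by omega
      obtain ⟨hq, hm, h₁, h₂, h₃⟩ :=
        ((f 0).isNoncrossingTreeOn_toGraph a).glue_inj ((f 1).isNoncrossingTreeOn_toGraph _)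
          ((f 2).isNoncrossingTreeOn_toGraph _) (by omega) (by omega)
          ((g 0).isNoncrossingTreeOn_toGraph a) ((g 1).isNoncrossingTreeOn_toGraph _)
          (hb ▸ (g 2).isNoncrossingTreeOn_toGraph _) (by omega) (by omega) h
      rw [← hq] at h₂
      rw [← hm] at h₃
      have e₀ : f 0 = g 0 := ih 0 (by omega) h₁
      have e₁ : f 1 = g 1 := ih 1 (by omega) h₂
      have e₂ : f 2 = g 2 := ih 2 (by omega) h₃
      congr 1
      funext i
      fin_cases i
      exacts [e₀, e₁, e₂]

lemma exists_toGraph_eq (n : ℕ) {a : ℕ} {G : SimpleGraph ℕ}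
    (h : IsNoncrossingTreeOn G a (a + n)) : ∃ t : PTree 3, t.internal = n ∧ t.toGraph a = G := by
  induction n using Nat.strong_induction_on generalizing a G with
  | _ n ih =>
    rcases n.eq_zero_or_pos with rfl | hn
    · exact ⟨leaf, rfl, h.eq_bot.symm⟩
    obtain ⟨q, m, T₁, T₂, T₃, haq, hqm, hmb, h₁, h₂, h₃, rfl⟩ := h.exists_glue (by omega)
    obtain ⟨i, rfl⟩ := Nat.exists_eq_add_of_le haq
    obtain ⟨j, rfl⟩ := Nat.exists_eq_add_of_le (Nat.succ_le_of_lt hqm)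
    obtain ⟨k, hk⟩ := Nat.exists_eq_add_of_le hmb
    rw [hk] at h₃
    obtain ⟨t₁, rfl, rfl⟩ := ih i (by omega) h₁
    obtain ⟨t₂, rfl, rfl⟩ := ih j (by omega) h₂
    obtain ⟨t₃, rfl, rfl⟩ := ih k (by omega) h₃
    refine ⟨node ![t₁, t₂, t₃], ?_, rfl⟩
    rw [internal_node_three]
    simp only [Matrix.cons_val]
    omega

end PTree

/-- For every `n ≥ 0`, the number of noncrossing trees on `n+1` linearly ordered vertices
equals the number of ternary planar rooted trees with exactly `n` internal vertices. -/
theorem card_noncrossingTrees_eq_card_ternary (n : ℕ) :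
    Nat.card {G : SimpleGraph (Fin (n + 1)) | G.IsTree ∧ G.Noncrossing} =
      Nat.card {t : PTree 3 | t.internal = n} := by
  have hgraph : ∀ t : PTree 3, t.internal = n → (t.toGraph 0).IsNoncrossingTreeOn 0 n := by
    rintro t rfl
    simpa using t.isNoncrossingTreeOn_toGraph 0
  symm
  rw [Nat.card_coe_set_eq, Nat.card_coe_set_eq]
  refine Set.BijOn.ncard_eq (f := fun t : PTree 3 ↦ (t.toGraph 0).comap
    (Fin.valEmbedding : Fin (n + 1) ↪ ℕ)) ⟨fun t ht ↦ ?_, fun t ht s hs hts ↦ ?_, ?_⟩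
  · exact ⟨(hgraph t ht).isTree_comap, fun u v x y ↦ (hgraph t ht).noncrossing u v x y⟩
  · refine PTree.toGraph_injective (a := 0) (ht.trans hs.symm) ?_
    rw [← (hgraph t ht).map_comap, ← (hgraph s hs).map_comap]
    exact congrArg (SimpleGraph.map Fin.valEmbedding) hts
  · rintro G ⟨hG, hG'⟩
    have h := SimpleGraph.IsNoncrossingTreeOn.of_isTree hG hG'
    obtain ⟨t, ht, htG⟩ :=
      PTree.exists_toGraph_eq n (a := 0) (G := G.map Fin.valEmbedding) (by rwa [Nat.zero_add])
    exact ⟨t, ht, (congrArg _ htG).trans (SimpleGraph.comap_map_eq _ _)⟩
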